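/- Let n₁, n₂ ≥ 1, 1 < p < q < ∞, 0 < β_i < n_i, 1/q = 1/p - β_i/n_i for i = 1,2, and let f̃(x₁,x₂) = (1+|x₁|^{qβ₁})^{-(1+n₁/(qβ₁))} (1+|x₂|^{qβ₂})^{-(1+n₂/(qβ₂))}. Then ‖𝓗_{β₁,β₂}(f̃)‖_{L^q(ℝ^{n₁}×ℝ^{n₂})} / ‖f̃‖_{L^p(ℝ^{n₁}×ℝ^{n₂})} = A₁A₂ where A_i = (p'/q)^{1/q} ((n_i/(qβ_i)) B(n_i/(qβ_i), n_i/(q'β_i)))^{-β_i/n_i}; in particular the constant A₁A₂ in the inequality ‖𝓗_{β₁,β₂}f‖_{L^q} ≤ A₁A₂‖f‖_{L^p} is attained and hence sharp. -/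

import Mathlib

open MeasureTheory Set
open scoped ENNReal

/-- The Euler Beta function `B(z,w) = ∫₀¹ t^(z-1) (1-t)^(w-1) dt`. -/
noncomputable def betaFn (z w : ℝ) : ℝ :=
  ∫ t in Ioo (0 : ℝ) 1, t ^ (z - 1) * (1 - t) ^ (w - 1)

/-- The two-fold fractional Hardy operator `𝓗_{β₁,β₂}` on `ℝ^{n₁} × ℝ^{n₂}`. -/
noncomputable def prodFracHardy₂ (n₁ n₂ : ℕ) (β₁ β₂ : ℝ)
    (f : EuclideanSpace ℝ (Fin n₁) × EuclideanSpace ℝ (Fin n₂) → ℝ≥0∞)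
    (x : EuclideanSpace ℝ (Fin n₁) × EuclideanSpace ℝ (Fin n₂)) : ℝ≥0∞ :=
  (volume (Metric.ball (0 : EuclideanSpace ℝ (Fin n₁)) ‖x.1‖)) ^ (β₁ / (n₁ : ℝ) - 1) *
  (volume (Metric.ball (0 : EuclideanSpace ℝ (Fin n₂)) ‖x.2‖)) ^ (β₂ / (n₂ : ℝ) - 1) *
    ∫⁻ y in (Metric.ball (0 : EuclideanSpace ℝ (Fin n₁)) ‖x.1‖) ×ˢ
        (Metric.ball (0 : EuclideanSpace ℝ (Fin n₂)) ‖x.2‖), f y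

open Module Metric in
/-- Polar coordinates for the Lebesgue integral of a radial function. -/
theorem lintegral_radial_addHaar {E : Type*} [NormedAddCommGroup E] [NormedSpace ℝ E]
    [FiniteDimensional ℝ E] [Nontrivial E] [MeasurableSpace E] [BorelSpace E]
    (μ : Measure E) [μ.IsAddHaarMeasure] {f : ℝ → ℝ≥0∞} (hf : Measurable f) :
    ∫⁻ x, f ‖x‖ ∂μ = finrank ℝ E * μ (ball 0 1) *
      ∫⁻ r in Ioi (0 : ℝ), ENNReal.ofReal (r ^ (finrank ℝ E - 1)) * f r :=
  calc
    ∫⁻ x, f ‖x‖ ∂μ = ∫⁻ x : ({(0)}ᶜ : Set E), f ‖x.1‖ ∂(μ.comap (↑)) := by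
      rw [lintegral_subtype_comap (measurableSet_singleton _).compl fun x ↦ f (‖x‖),
        restrict_compl_singleton]
    _ = ∫⁻ x, f x.2 ∂μ.toSphere.prod (.volumeIoiPow (finrank ℝ E - 1)) := by
      simpa using μ.measurePreserving_homeomorphUnitSphereProd.lintegral_comp
        (f := f ∘ Subtype.val ∘ Prod.snd)
        (hf.comp (measurable_subtype_coe.comp measurable_snd))
    _ = μ.toSphere univ * ∫⁻ x : Ioi (0 : ℝ), f x ∂.volumeIoiPow (finrank ℝ E - 1) := by
      simpa using lintegral_prod_mul (μ := μ.toSphere)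
        (ν := .volumeIoiPow (finrank ℝ E - 1)) (f := fun _ ↦ 1) (g := f ∘ Subtype.val)
        aemeasurable_const (hf.comp measurable_subtype_coe).aemeasurable
    _ = _ := by
      rw [μ.toSphere_apply_univ, Measure.volumeIoiPow,
        lintegral_withDensity_eq_lintegral_mul _ (by fun_prop)
          (g := fun r : Ioi (0 : ℝ) ↦ f r) (hf.comp measurable_subtype_coe)]
      congr 1
      exact lintegral_subtype_comap measurableSet_Ioi
        fun r ↦ ENNReal.ofReal (r ^ (finrank ℝ E - 1)) * f r

theorem lintegral_Ioo_beta {u v : ℝ} (hu : 0 < u) (hv : 0 < v) :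
    ∫⁻ t in Ioo (0 : ℝ) 1, ENNReal.ofReal (t ^ (u - 1) * (1 - t) ^ (v - 1)) =
      ENNReal.ofReal (ProbabilityTheory.beta u v) := by
  have hB := ProbabilityTheory.beta_pos hu hv
  have h := ProbabilityTheory.lintegral_betaPDF_eq_one hu hv
  simp_rw [ProbabilityTheory.lintegral_betaPDF, mul_assoc,
    ENNReal.ofReal_mul (one_div_pos.2 hB).le] at h
  rw [lintegral_const_mul _ (by fun_prop)] at h
  calc _ = ENNReal.ofReal (ProbabilityTheory.beta u v) *
        (ENNReal.ofReal (1 / ProbabilityTheory.beta u v) *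
          ∫⁻ t in Ioo (0 : ℝ) 1, ENNReal.ofReal (t ^ (u - 1) * (1 - t) ^ (v - 1))) := by
        rw [← mul_assoc, ← ENNReal.ofReal_mul hB.le, mul_one_div_cancel hB.ne',
          ENNReal.ofReal_one, one_mul]
    _ = _ := by rw [h, mul_one]

theorem betaFn_eq_beta {u v : ℝ} (hu : 0 < u) (hv : 0 < v) :
    betaFn u v = ProbabilityTheory.beta u v := by
  rw [betaFn, integral_eq_lintegral_of_nonneg_ae, lintegral_Ioo_beta hu hv,
    ENNReal.toReal_ofReal (ProbabilityTheory.beta_pos hu hv).le]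
  · filter_upwards [ae_restrict_mem measurableSet_Ioo] with t ht
    exact mul_nonneg (Real.rpow_nonneg ht.1.le _) (Real.rpow_nonneg (by linarith [ht.2]) _)
  · exact Measurable.aestronglyMeasurable (by fun_prop)

/-- The substitution `t = r ^ b / (1 + r ^ b)` in the Beta integral. -/
theorem lintegral_Ioi_rpow_mul_one_add_rpow {b u v : ℝ} (hb : 0 < b) (hu : 0 < u) (hv : 0 < v) :
    ∫⁻ r in Ioi (0 : ℝ), ENNReal.ofReal (r ^ (b * u - 1) * (1 + r ^ b) ^ (-(u + v))) =
      ENNReal.ofReal (ProbabilityTheory.beta u v / b) := by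
  have hpos : ∀ r ∈ Ioi (0 : ℝ), 0 < r ^ b := fun r hr ↦ Real.rpow_pos_of_pos hr b
  have himage : (fun r : ℝ ↦ r ^ b / (1 + r ^ b)) '' Ioi 0 = Ioo 0 1 := by
    ext t
    constructor
    · rintro ⟨r, hr, rfl⟩
      have := hpos r hr
      exact ⟨by positivity, (div_lt_one (by positivity)).2 (by linarith)⟩
    · rintro ⟨h0, h1⟩
      have h1' : 0 < 1 - t := by linarith
      have hq : 0 < t / (1 - t) := by positivity
      refine ⟨(t / (1 - t)) ^ (1 / b), Real.rpow_pos_of_pos hq _, ?_⟩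
      simp only
      rw [← Real.rpow_mul hq.le, one_div_mul_cancel hb.ne', Real.rpow_one]
      field_simp
      ring
  have hinj : InjOn (fun r : ℝ ↦ r ^ b / (1 + r ^ b)) (Ioi 0) := by
    intro r hr s hs h
    have h1 := hpos r hr
    have h2 := hpos s hs
    simp only at h
    rw [div_eq_div_iff (by positivity) (by positivity)] at h
    exact Real.rpow_left_injOn hb.ne' (mem_Ioi.1 hr).le (mem_Ioi.1 hs).le (by simp only; linarith)
  have hderiv : ∀ r ∈ Ioi (0 : ℝ), HasDerivWithinAt (fun r : ℝ ↦ r ^ b / (1 + r ^ b))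
      (b * r ^ (b - 1) / (1 + r ^ b) ^ 2) (Ioi 0) r := by
    intro r hr
    have h1 := hpos r hr
    have hd : HasDerivAt (fun r : ℝ ↦ r ^ b) (b * r ^ (b - 1)) r :=
      Real.hasDerivAt_rpow_const (Or.inl (ne_of_gt hr))
    refine ((hd.div (hd.const_add 1) (by positivity)).congr_deriv ?_).hasDerivWithinAt
    congr 1
    ring
  have h := lintegral_image_eq_lintegral_abs_deriv_mul measurableSet_Ioi hderiv hinj
    fun t ↦ ENNReal.ofReal (t ^ (u - 1) * (1 - t) ^ (v - 1))
  rw [himage, lintegral_Ioo_beta hu hv] at h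
  rw [div_eq_inv_mul, ENNReal.ofReal_mul (by positivity), h,
    ← lintegral_const_mul' _ _ ENNReal.ofReal_ne_top]
  refine setLIntegral_congr_fun measurableSet_Ioi fun r hr ↦ ?_
  have h1 := hpos r hr
  have h2 : 0 < 1 + r ^ b := by positivity
  have hr0 : (0 : ℝ) < r := hr
  rw [abs_of_nonneg (by positivity), ← ENNReal.ofReal_mul (by positivity),
    ← ENNReal.ofReal_mul (by positivity)]
  congr 1
  have e1 : 1 - r ^ b / (1 + r ^ b) = (1 + r ^ b)⁻¹ := by field_simp; ring
  have e2 : r ^ (b * u - 1) = r ^ (b - 1) * (r ^ b) ^ (u - 1) := by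
    rw [← Real.rpow_mul hr0.le, ← Real.rpow_add hr0]
    congr 1; ring
  have e3 : (1 + r ^ b) ^ (-(u + v)) =
      ((1 + r ^ b) ^ 2)⁻¹ * ((1 + r ^ b) ^ (u - 1))⁻¹ * ((1 + r ^ b) ^ (v - 1))⁻¹ := by
    rw [← Real.rpow_natCast, ← Real.rpow_neg h2.le, ← Real.rpow_neg h2.le,
      ← Real.rpow_neg h2.le, ← Real.rpow_add h2, ← Real.rpow_add h2]
    congr 1; push_cast; ring
  rw [e1, e2, e3, Real.div_rpow h1.le h2.le, Real.inv_rpow h2.le]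
  field_simp

theorem lintegral_Ioo_pow_mul_one_add_rpow {n : ℕ} (hn : 1 ≤ n) {b R : ℝ} (hb : 0 < b)
    (hR : 0 < R) :
    ∫⁻ r in Ioo (0 : ℝ) R, ENNReal.ofReal (r ^ (n - 1) * (1 + r ^ b) ^ (-(1 + n / b))) =
      ENNReal.ofReal (R ^ n * (1 + R ^ b) ^ (-(n / b)) / n) := by
  have hn0 : (0 : ℝ) < n := by exact_mod_cast hn
  have hone : ∀ r : ℝ, 0 ≤ r → 0 < 1 + r ^ b := fun r hr ↦ by
    have := Real.rpow_nonneg hr b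
    linarith
  have hcont : ContinuousOn (fun r : ℝ ↦ r ^ (n - 1) * (1 + r ^ b) ^ (-(1 + n / b)))
      (Icc 0 R) := by
    refine (continuous_pow _).continuousOn.mul (ContinuousOn.rpow_const
      (continuous_const.add (Real.continuous_rpow_const hb.le)).continuousOn fun r hr ↦
        Or.inl (hone r hr.1).ne')
  have hcont' : ContinuousOn (fun r : ℝ ↦ r ^ n * (1 + r ^ b) ^ (-(n / b)) / n)
      (Icc 0 R) := by
    refine ((continuous_pow _).continuousOn.mul (ContinuousOn.rpow_const
      (continuous_const.add (Real.continuous_rpow_const hb.le)).continuousOn fun r hr ↦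
        Or.inl (hone r hr.1).ne')).div_const _
  have hderiv : ∀ r ∈ Ioo (0 : ℝ) R,
      HasDerivAt (fun r : ℝ ↦ r ^ n * (1 + r ^ b) ^ (-(n / b)) / n)
        (r ^ (n - 1) * (1 + r ^ b) ^ (-(1 + n / b))) r := by
    intro r hr
    have hr0 : 0 < r := hr.1
    have h1 := hone r hr.1.le
    have hd : HasDerivAt (fun r : ℝ ↦ r ^ b) (b * r ^ (b - 1)) r :=
      Real.hasDerivAt_rpow_const (Or.inl hr0.ne')
    refine (((hasDerivAt_pow n r).mul
      ((hd.const_add 1).rpow_const (Or.inl h1.ne'))).div_const (n : ℝ)).congr_deriv ?_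
    have e1 : (1 + r ^ b) ^ (-(n / b)) = (1 + r ^ b) ^ (-(1 + n / b)) * (1 + r ^ b) := by
      rw [← Real.rpow_add_one h1.ne']
      congr 1; ring
    have e2 : -(n / b) - 1 = -(1 + n / b) := by ring
    have e3 : r ^ b = r ^ (b - 1) * r := by
      rw [← Real.rpow_add_one hr0.ne']
      congr 1; ring
    have e4 : r ^ n = r ^ (n - 1) * r := by
      rw [← pow_succ]
      congr 1; omega
    rw [e2, e1, e4]
    generalize (1 + r ^ b) ^ (-(1 + n / b)) = X
    rw [e3]
    field_simp
    ring
  have hint : IntegrableOn (fun r : ℝ ↦ r ^ (n - 1) * (1 + r ^ b) ^ (-(1 + n / b))) (Ioc 0 R) :=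
    (hcont.integrableOn_Icc).mono_set Ioc_subset_Icc_self
  have h := intervalIntegral.integral_eq_sub_of_hasDerivAt_of_le hR.le hcont' hderiv
    ((intervalIntegrable_iff_integrableOn_Ioc_of_le hR.le).2 hint)
  rw [intervalIntegral.integral_of_le hR.le, zero_pow (by omega), zero_mul, zero_div,
    sub_zero] at h
  rw [← h, ofReal_integral_eq_lintegral_ofReal hint, Measure.restrict_congr_set Ioo_ae_eq_Ioc]
  filter_upwards [ae_restrict_mem measurableSet_Ioc] with r hr
  exact mul_nonneg (pow_nonneg hr.1.le _) (Real.rpow_nonneg (hone r hr.1.le).le _)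

theorem lintegral_ball_one_add_rpow {n : ℕ} (hn : 1 ≤ n) {b R : ℝ} (hb : 0 < b) (hR : 0 < R) :
    ∫⁻ y in Metric.ball (0 : EuclideanSpace ℝ (Fin n)) R,
        ENNReal.ofReal ((1 + ‖y‖ ^ b) ^ (-(1 + n / b))) =
      volume (Metric.ball (0 : EuclideanSpace ℝ (Fin n)) 1) *
        ENNReal.ofReal (R ^ n * (1 + R ^ b) ^ (-(n / b))) := by
  have : Nonempty (Fin n) := ⟨⟨0, hn⟩⟩
  have hn0 : (0 : ℝ) < n := by exact_mod_cast hn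
  have hm : Measurable ((Iio R).indicator
      fun r : ℝ ↦ ENNReal.ofReal ((1 + r ^ b) ^ (-(1 + n / b)))) :=
    Measurable.indicator (by fun_prop) measurableSet_Iio
  have h := lintegral_radial_addHaar (volume : Measure (EuclideanSpace ℝ (Fin n))) hm
  have hl : ∀ y : EuclideanSpace ℝ (Fin n), (Iio R).indicator
      (fun r : ℝ ↦ ENNReal.ofReal ((1 + r ^ b) ^ (-(1 + n / b)))) ‖y‖ =
      (Metric.ball 0 R).indicator
        (fun y ↦ ENNReal.ofReal ((1 + ‖y‖ ^ b) ^ (-(1 + n / b)))) y := by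
    intro y
    simp [indicator]
  simp_rw [hl] at h
  rw [lintegral_indicator measurableSet_ball] at h
  rw [h, finrank_euclideanSpace_fin]
  have hr : ∀ r : ℝ, ENNReal.ofReal (r ^ (n - 1)) * (Iio R).indicator
      (fun r : ℝ ↦ ENNReal.ofReal ((1 + r ^ b) ^ (-(1 + n / b)))) r =
      (Iio R).indicator (fun r : ℝ ↦ ENNReal.ofReal (r ^ (n - 1)) *
        ENNReal.ofReal ((1 + r ^ b) ^ (-(1 + n / b)))) r := by
    intro r
    simp [indicator]
  simp_rw [hr]
  rw [lintegral_indicator measurableSet_Iio, Measure.restrict_restrict measurableSet_Iio,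
    inter_comm, Ioi_inter_Iio, setLIntegral_congr_fun (g := fun r : ℝ ↦
      ENNReal.ofReal (r ^ (n - 1) * (1 + r ^ b) ^ (-(1 + n / b)))) measurableSet_Ioo
      fun r hr ↦ (ENNReal.ofReal_mul (pow_nonneg hr.1.le _)).symm,
    lintegral_Ioo_pow_mul_one_add_rpow hn hb hR, mul_comm (n : ℝ≥0∞), mul_assoc,
    ← ENNReal.ofReal_natCast, ← ENNReal.ofReal_mul hn0.le]
  congr 2
  field_simp

/-- The one-parameter fractional Hardy operator on `ℝⁿ`. -/
noncomputable def fracHardy (n : ℕ) (β : ℝ) (g : EuclideanSpace ℝ (Fin n) → ℝ≥0∞)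
    (x : EuclideanSpace ℝ (Fin n)) : ℝ≥0∞ :=
  volume (Metric.ball (0 : EuclideanSpace ℝ (Fin n)) ‖x‖) ^ (β / (n : ℝ) - 1) *
    ∫⁻ y in Metric.ball (0 : EuclideanSpace ℝ (Fin n)) ‖x‖, g y

theorem prodFracHardy₂_mul (n₁ n₂ : ℕ) (β₁ β₂ : ℝ)
    {g₁ : EuclideanSpace ℝ (Fin n₁) → ℝ≥0∞} {g₂ : EuclideanSpace ℝ (Fin n₂) → ℝ≥0∞}
    (hg₁ : Measurable g₁) (hg₂ : Measurable g₂)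
    (x : EuclideanSpace ℝ (Fin n₁) × EuclideanSpace ℝ (Fin n₂)) :
    prodFracHardy₂ n₁ n₂ β₁ β₂ (fun y ↦ g₁ y.1 * g₂ y.2) x =
      fracHardy n₁ β₁ g₁ x.1 * fracHardy n₂ β₂ g₂ x.2 := by
  rw [prodFracHardy₂, fracHardy, fracHardy, Measure.volume_eq_prod, ← Measure.prod_restrict,
    lintegral_prod_mul hg₁.aemeasurable hg₂.aemeasurable]
  ring

theorem fracHardy_one_add_rpow {n : ℕ} (hn : 1 ≤ n) {β b V : ℝ} (hb : 0 < b)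
    (hV0 : 0 < V) (hV : volume (Metric.ball (0 : EuclideanSpace ℝ (Fin n)) 1) = ENNReal.ofReal V)
    {x : EuclideanSpace ℝ (Fin n)} (hx : x ≠ 0) :
    fracHardy n β (fun y ↦ ENNReal.ofReal ((1 + ‖y‖ ^ b) ^ (-(1 + n / b)))) x =
      ENNReal.ofReal (V ^ (β / n) * ‖x‖ ^ β * (1 + ‖x‖ ^ b) ^ (-(n / b))) := by
  have hn0 : (0 : ℝ) < n := by exact_mod_cast hn
  have hR : 0 < ‖x‖ := norm_pos_iff.2 hx
  rw [fracHardy, lintegral_ball_one_add_rpow hn hb hR, Measure.addHaar_ball_of_pos _ _ hR, hV,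
    finrank_euclideanSpace_fin, ← ENNReal.ofReal_mul (by positivity),
    ENNReal.ofReal_rpow_of_pos (by positivity), ← ENNReal.ofReal_mul (by positivity),
    ← ENNReal.ofReal_mul (by positivity)]
  congr 1
  have e : ‖x‖ ^ β = (‖x‖ ^ n) ^ (β / n) := by
    rw [← Real.rpow_natCast, ← Real.rpow_mul hR.le, mul_div_cancel₀ _ hn0.ne']
  rw [e, Real.rpow_sub_one (by positivity), Real.mul_rpow (by positivity) (by positivity)]
  field_simp

theorem exists_volume_ball_eq_ofReal (n : ℕ) : ∃ V : ℝ, 0 < V ∧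
    volume (Metric.ball (0 : EuclideanSpace ℝ (Fin n)) 1) = ENNReal.ofReal V :=
  ⟨(volume (Metric.ball (0 : EuclideanSpace ℝ (Fin n)) 1)).toReal,
    ENNReal.toReal_pos (Metric.measure_ball_pos _ _ one_pos).ne' measure_ball_lt_top.ne,
    (ENNReal.ofReal_toReal measure_ball_lt_top.ne).symm⟩

theorem aemeasurable_fracHardy_one_add_rpow {n : ℕ} (hn : 1 ≤ n) {β b : ℝ} (hb : 0 < b) :
    AEMeasurable (fracHardy n β
      fun y ↦ ENNReal.ofReal ((1 + ‖y‖ ^ b) ^ (-(1 + n / b)))) := by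
  have : Nonempty (Fin n) := ⟨⟨0, hn⟩⟩
  obtain ⟨V, hV0, hV⟩ := exists_volume_ball_eq_ofReal n
  refine ⟨fun x ↦ ENNReal.ofReal (V ^ (β / n) * ‖x‖ ^ β * (1 + ‖x‖ ^ b) ^ (-(n / b))),
    by fun_prop, ?_⟩
  filter_upwards [compl_mem_ae_iff.2 (measure_singleton
    (μ := (volume : Measure (EuclideanSpace ℝ (Fin n)))) 0)] with x hx
  exact fracHardy_one_add_rpow hn hb hV0 hV hx

theorem lintegral_norm_rpow_mul_one_add_rpow {n : ℕ} (hn : 1 ≤ n) {b s w : ℝ} (hb : 0 < b)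
    (hs : 0 < n / b + s) (hw : n / b + s < w) :
    ∫⁻ x : EuclideanSpace ℝ (Fin n), ENNReal.ofReal (‖x‖ ^ (b * s) * (1 + ‖x‖ ^ b) ^ (-w)) =
      volume (Metric.ball (0 : EuclideanSpace ℝ (Fin n)) 1) *
        ENNReal.ofReal (n / b * ProbabilityTheory.beta (n / b + s) (w - (n / b + s))) := by
  have : Nonempty (Fin n) := ⟨⟨0, hn⟩⟩
  have hn0 : (0 : ℝ) < n := by exact_mod_cast hn
  have hw' : 0 < w - (n / b + s) := by linarith
  rw [lintegral_radial_addHaar volume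
    (f := fun r ↦ ENNReal.ofReal (r ^ (b * s) * (1 + r ^ b) ^ (-w))) (by fun_prop),
    finrank_euclideanSpace_fin,
    setLIntegral_congr_fun (g := fun r : ℝ ↦ ENNReal.ofReal (r ^ (b * (n / b + s) - 1) *
      (1 + r ^ b) ^ (-((n / b + s) + (w - (n / b + s)))))) measurableSet_Ioi fun r hr ↦ ?_,
    lintegral_Ioi_rpow_mul_one_add_rpow hb hs hw', mul_comm (n : ℝ≥0∞), mul_assoc,
    ← ENNReal.ofReal_natCast, ← ENNReal.ofReal_mul hn0.le]
  · congr 2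
    field_simp
  · have hr0 : (0 : ℝ) < r := hr
    simp only
    rw [← ENNReal.ofReal_mul (by positivity), ← mul_assoc, ← Real.rpow_natCast,
      ← Real.rpow_add hr0]
    congr 3
    · rw [Nat.cast_sub hn]
      field_simp
      push_cast
      ring
    · ring

theorem beta_add_one_sub_one {u v : ℝ} (hu : 0 < u) (hv : 0 < v - 1) :
    ProbabilityTheory.beta (u + 1) (v - 1) = u / (v - 1) * ProbabilityTheory.beta u v := by
  have h := Real.Gamma_add_one hv.ne'
  rw [sub_add_cancel] at h
  rw [ProbabilityTheory.beta, ProbabilityTheory.beta, Real.Gamma_add_one hu.ne', h,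
    show u + 1 + (v - 1) = u + v by ring]
  field_simp

theorem fracHardy_extremal {n : ℕ} (hn : 1 ≤ n) {β p q : ℝ} (hp : 1 < p) (hpq : p < q)
    (hβ : 0 < β) (hscal : 1 / q = 1 / p - β / n) :
    (∫⁻ x, fracHardy n β
        (fun y ↦ ENNReal.ofReal ((1 + ‖y‖ ^ (q * β)) ^ (-(1 + n / (q * β))))) x ^ q) ^ (1 / q) =
      ENNReal.ofReal (((p / (p - 1)) / q) ^ (1 / q) *
        ((n / (q * β)) * betaFn (n / (q * β)) (n / ((q / (q - 1)) * β))) ^ (-β / n)) *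
      (∫⁻ x : EuclideanSpace ℝ (Fin n),
        ENNReal.ofReal ((1 + ‖x‖ ^ (q * β)) ^ (-(1 + n / (q * β)))) ^ p) ^ (1 / p) := by
  have : Nonempty (Fin n) := ⟨⟨0, hn⟩⟩
  have hn0 : (0 : ℝ) < n := by exact_mod_cast hn
  have hp0 : 0 < p := by linarith
  have hp1 : 0 < p - 1 := by linarith
  have hq0 : 0 < q := by linarith
  have hqp : 0 < q - p := by linarith
  have hb : 0 < q * β := by positivity
  obtain ⟨V, hV0, hV⟩ := exists_volume_ball_eq_ofReal n
  have hβn : β / n = 1 / p - 1 / q := by linarith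
  have ha : n / (q * β) = p / (q - p) := by
    have : n / (q * β) = (q * (β / n))⁻¹ := by field_simp
    rw [this, hβn]
    field_simp
  have hv : n / ((q / (q - 1)) * β) = p * (q - 1) / (q - p) := by
    have : n / ((q / (q - 1)) * β) = n / (q * β) * (q - 1) := by
      have : q - 1 ≠ 0 := by linarith
      field_simp
    rw [this, ha]
    ring
  have ha0 : 0 < p / (q - p) := by positivity
  have hv0 : 0 < p * (q - 1) / (q - p) :=
    div_pos (mul_pos hp0 (by linarith)) hqp
  have hv1 : p * (q - 1) / (q - p) - 1 = q * (p - 1) / (q - p) := by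
    field_simp
    ring
  have hv1' : 0 < p * (q - 1) / (q - p) - 1 := by rw [hv1]; positivity
  set B := ProbabilityTheory.beta (p / (q - p)) (p * (q - 1) / (q - p)) with hB
  have hB0 : 0 < B := ProbabilityTheory.beta_pos ha0 hv0
  have hright : ∫⁻ x : EuclideanSpace ℝ (Fin n),
      ENNReal.ofReal ((1 + ‖x‖ ^ (q * β)) ^ (-(1 + n / (q * β)))) ^ p =
        ENNReal.ofReal (V * (p / (q - p) * B)) := by
    have h := lintegral_norm_rpow_mul_one_add_rpow hn (s := 0)
      (w := p / (q - p) + p * (q - 1) / (q - p)) hb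
      (by rw [ha]; linarith) (by rw [ha]; linarith)
    rw [ha, hV, ← ENNReal.ofReal_mul hV0.le, add_zero, add_sub_cancel_left, ← hB] at h
    rw [← h, ha]
    refine lintegral_congr fun x ↦ ?_
    have h1 : 0 < 1 + ‖x‖ ^ (q * β) := by positivity
    rw [ENNReal.ofReal_rpow_of_pos (by positivity), ← Real.rpow_mul h1.le, mul_zero,
      Real.rpow_zero, one_mul]
    congr 2
    field_simp
    ring
  have hleft : ∫⁻ x, fracHardy n β
      (fun y ↦ ENNReal.ofReal ((1 + ‖y‖ ^ (q * β)) ^ (-(1 + n / (q * β))))) x ^ q =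
        ENNReal.ofReal (V ^ (q / p) * (p / (p - 1) / q) * (p / (q - p) * B)) := by
    have h := lintegral_norm_rpow_mul_one_add_rpow hn (s := 1)
      (w := p / (q - p) + p * (q - 1) / (q - p)) hb
      (by rw [ha]; linarith) (by rw [ha]; linarith)
    rw [ha, hV, ← ENNReal.ofReal_mul hV0.le, show p / (q - p) + p * (q - 1) / (q - p) -
      (p / (q - p) + 1) = p * (q - 1) / (q - p) - 1 by ring, beta_add_one_sub_one ha0 hv1',
      ← hB, hv1] at h
    have hVq : V ^ (q / p) = V ^ (β / n * q) * V := by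
      rw [← Real.rpow_add_one hV0.ne', hβn]
      congr 1
      field_simp
      ring
    have hc : V ^ (q / p) * (p / (p - 1) / q) * (p / (q - p) * B) = V ^ (β / n * q) *
        (V * (p / (q - p) * (p / (q - p) / (q * (p - 1) / (q - p)) * B))) := by
      rw [hVq]
      field_simp
    rw [hc, ENNReal.ofReal_mul (by positivity), ← h,
      ← lintegral_const_mul' _ _ ENNReal.ofReal_ne_top]
    refine lintegral_congr_ae ?_
    filter_upwards [compl_mem_ae_iff.2 (measure_singleton
      (μ := (volume : Measure (EuclideanSpace ℝ (Fin n)))) 0)] with x hx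
    have hx0 : x ≠ 0 := hx
    have hR : 0 < ‖x‖ := norm_pos_iff.2 hx0
    have h1 : 0 < 1 + ‖x‖ ^ (q * β) := by positivity
    rw [fracHardy_one_add_rpow hn hb hV0 hV hx0, ENNReal.ofReal_rpow_of_pos (by positivity),
      ← ENNReal.ofReal_mul (by positivity), Real.mul_rpow (by positivity) (by positivity),
      Real.mul_rpow (by positivity) (by positivity), ← Real.rpow_mul hV0.le,
      ← Real.rpow_mul hR.le, ← Real.rpow_mul h1.le, ha, mul_assoc]
    congr 4
    · ring
    · field_simp
      ring
  have hK : 0 < p / (q - p) * B := by positivity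
  rw [hleft, hright, ha, hv, betaFn_eq_beta ha0 hv0, ← hB,
    ENNReal.ofReal_rpow_of_pos (by positivity), ENNReal.ofReal_rpow_of_pos (by positivity),
    ← ENNReal.ofReal_mul (by positivity)]
  congr 1
  rw [Real.mul_rpow (by positivity) hK.le, Real.mul_rpow (by positivity) (by positivity),
    Real.mul_rpow hV0.le hK.le, ← Real.rpow_mul hV0.le]
  have e1 : q / p * (1 / q) = 1 / p := by field_simp
  have e2 : (p / (q - p) * B) ^ (1 / q) =
      (p / (q - p) * B) ^ (-β / n) * (p / (q - p) * B) ^ (1 / p) := by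
    rw [← Real.rpow_add hK, neg_div, hscal]
    congr 1; ring
  rw [e1, e2]
  ring

/-- The function `f̃(x₁,x₂) = (1+|x₁|^{qβ₁})^{-(1+n₁/(qβ₁))}(1+|x₂|^{qβ₂})^{-(1+n₂/(qβ₂))}`
is extremal: its `L^q`-`L^p` ratio under `𝓗_{β₁,β₂}` attains the sharp constant `A₁A₂`. -/
theorem prodFracHardy₂_extremal (n₁ n₂ : ℕ) (hn₁ : 1 ≤ n₁) (hn₂ : 1 ≤ n₂)
    (β₁ β₂ p q : ℝ) (hp : 1 < p) (hpq : p < q)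
    (hβ₁0 : 0 < β₁) (hβ₁n : β₁ < n₁) (hβ₂0 : 0 < β₂) (hβ₂n : β₂ < n₂)
    (hscal₁ : 1 / q = 1 / p - β₁ / n₁) (hscal₂ : 1 / q = 1 / p - β₂ / n₂)
    (ftilde : EuclideanSpace ℝ (Fin n₁) × EuclideanSpace ℝ (Fin n₂) → ℝ≥0∞)
    (hftilde : ∀ x, ftilde x =
      ENNReal.ofReal ((1 + ‖x.1‖ ^ (q * β₁)) ^ (-(1 + n₁ / (q * β₁))) *
        (1 + ‖x.2‖ ^ (q * β₂)) ^ (-(1 + n₂ / (q * β₂))))) :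
    (∫⁻ x, prodFracHardy₂ n₁ n₂ β₁ β₂ ftilde x ^ q) ^ (1 / q)
      = ENNReal.ofReal
          ((((p / (p - 1)) / q) ^ (1 / q) *
              ((n₁ / (q * β₁)) *
                betaFn (n₁ / (q * β₁)) (n₁ / ((q / (q - 1)) * β₁))) ^ (-β₁ / n₁)) *
           (((p / (p - 1)) / q) ^ (1 / q) *
              ((n₂ / (q * β₂)) *
                betaFn (n₂ / (q * β₂)) (n₂ / ((q / (q - 1)) * β₂))) ^ (-β₂ / n₂))) *
        (∫⁻ x, ftilde x ^ p) ^ (1 / p) := by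
  set g₁ : EuclideanSpace ℝ (Fin n₁) → ℝ≥0∞ :=
    fun y ↦ ENNReal.ofReal ((1 + ‖y‖ ^ (q * β₁)) ^ (-(1 + n₁ / (q * β₁)))) with hg₁
  set g₂ : EuclideanSpace ℝ (Fin n₂) → ℝ≥0∞ :=
    fun y ↦ ENNReal.ofReal ((1 + ‖y‖ ^ (q * β₂)) ^ (-(1 + n₂ / (q * β₂)))) with hg₂
  have hm₁ : Measurable g₁ := by fun_prop
  have hm₂ : Measurable g₂ := by fun_prop
  have hp0 : 0 < p := by linarith
  have hq0 : 0 < q := by linarith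
  obtain rfl : ftilde = fun y ↦ g₁ y.1 * g₂ y.2 := by
    funext x
    rw [hftilde, ENNReal.ofReal_mul (by positivity)]
  have hA₁ : 0 ≤ ((p / (p - 1)) / q) ^ (1 / q) * ((n₁ / (q * β₁)) *
      betaFn (n₁ / (q * β₁)) (n₁ / ((q / (q - 1)) * β₁))) ^ (-β₁ / n₁) := by
    have hn₁0 : (0 : ℝ) < n₁ := by exact_mod_cast hn₁
    have hp1 : 0 < p - 1 := by linarith
    have hq1 : 0 < q - 1 := by linarith
    rw [betaFn_eq_beta (by positivity) (by positivity)]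
    have := ProbabilityTheory.beta_pos (α := n₁ / (q * β₁))
      (β := n₁ / ((q / (q - 1)) * β₁)) (by positivity) (by positivity)
    positivity
  have hH₁ : AEMeasurable (fracHardy n₁ β₁ g₁) :=
    aemeasurable_fracHardy_one_add_rpow hn₁ (by positivity)
  have hH₂ : AEMeasurable (fracHardy n₂ β₂ g₂) :=
    aemeasurable_fracHardy_one_add_rpow hn₂ (by positivity)
  simp_rw [prodFracHardy₂_mul n₁ n₂ β₁ β₂ hm₁ hm₂, ENNReal.mul_rpow_of_nonneg _ _ hq0.le,
    ENNReal.mul_rpow_of_nonneg _ _ hp0.le]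
  rw [Measure.volume_eq_prod,
    lintegral_prod_mul (hH₁.pow_const q) (hH₂.pow_const q),
    lintegral_prod_mul (hm₁.pow_const p).aemeasurable (hm₂.pow_const p).aemeasurable,
    ENNReal.mul_rpow_of_nonneg _ _ (by positivity), ENNReal.mul_rpow_of_nonneg _ _ (by positivity),
    fracHardy_extremal hn₁ hp hpq hβ₁0 hscal₁, fracHardy_extremal hn₂ hp hpq hβ₂0 hscal₂,
    ENNReal.ofReal_mul hA₁]
  ring
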